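/- arXiv:0911.5546 — 2 statements merged into one kernel-verified Lean document; each statement's English description precedes it below -/
import Mathlib

section
/- Let (A,E) be a noncommutative probability space, let a₁,…,a_n ∈ A, let 1 ≤ i ≤ n−1, and let W be a partition of {1,…,n} such that i and i+1 belong to the same block of W. Then k_W(a₁,…,a_{i−1},a_i,a_{i+1},a_{i+2},…,a_n) − k_W(a₁,…,a_{i−1},a_{i+1},a_i,a_{i+2},…,a_n) = k_{W′}(a₁,…,a_{i−1},[a_i,a_{i+1}],a_{i+2},…,a_n), where [a,b] = ab − ba and W′ is the partition of {1,…,n−1} obtained from W by merging i and i+1 into one element and relabeling i+2,…,n as i+1,…,n−1. -/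
open scoped Classical BigOperators
open Filter

noncomputable section

namespace HOF

instance setoidFinite {α : Type*} [Finite α] : Finite (Setoid α) :=
  Finite.of_injective (fun V : Setoid α => V.r)
    (fun V W h => Setoid.ext fun a b => by rw [show V.r = W.r from h])

instance setoidFintype {α : Type*} [Finite α] : Fintype (Setoid α) := Fintype.ofFinite _

instance matrixMeasurableSpace {n : ℕ} : MeasurableSpace (Matrix (Fin n) (Fin n) ℂ) :=
  MeasurableSpace.pi

variable {A : Type*}

/-- Ordered product of the `a i` over the indices in `S`, in increasing order of indices. -/
def ordProd [Monoid A] {l : ℕ} (a : Fin l → A) (S : Set (Fin l)) : A :=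
  (((List.finRange l).filter (fun i => decide (i ∈ S))).map a).prod

/-- The moment functional `E_V` associated to a set partition `V` (encoded as a `Setoid`):
the product over the blocks of `V` of `E` applied to the ordered product over each block. -/
def momentV {R : Type*} [CommRing R] [Monoid A] {l : ℕ} (E : A → R)
    (V : Setoid (Fin l)) (a : Fin l → A) : R :=
  ∏ᶠ B ∈ Setoid.classes V, E (ordProd a B)

/-- `k` is the family of tensor cumulants associated to the expectation `E`:
for every partition `V`, `∑_{W ≤ V} k_W = E_V`. -/
def IsCumulant {R : Type*} [CommRing R] [Monoid A] (E : A → R)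
    (k : ∀ {l : ℕ}, Setoid (Fin l) → (Fin l → A) → R) : Prop :=
  ∀ (l : ℕ) (V : Setoid (Fin l)) (a : Fin l → A),
    ∑ W ∈ Finset.univ.filter (fun W : Setoid (Fin l) => W ≤ V), k W a = momentV E V a

/-- Number of blocks of a partition. -/
def numBlocks {l : ℕ} (V : Setoid (Fin l)) : ℕ := (Setoid.classes V).ncard

/-- The partition of cycles of a permutation. -/
def cycleSetoid {l : ℕ} (π : Equiv.Perm (Fin l)) : Setoid (Fin l) :=
  ⟨π.SameCycle, ⟨fun x => Equiv.Perm.SameCycle.refl π x, fun h => h.symm, fun h h' => h.trans h'⟩⟩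

/-- Number of cycles of a permutation. -/
def numCycles {l : ℕ} (π : Equiv.Perm (Fin l)) : ℕ := numBlocks (cycleSetoid π)

/-- `π ≤ V` : every cycle of `π` is contained in a block of `V`, i.e. `(V, π)` is a
partitioned permutation. -/
def permLePartition {l : ℕ} (π : Equiv.Perm (Fin l)) (V : Setoid (Fin l)) : Prop :=
  ∀ i, V.r i (π i)

/-- Length `|π| = l - #π` of a permutation. -/
def permLen {l : ℕ} (π : Equiv.Perm (Fin l)) : ℤ := (l : ℤ) - numCycles π

/-- Length `|(V,π)| = |π| + 2(#π - #V)` of a partitioned permutation. -/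
def ppLen {l : ℕ} (V : Setoid (Fin l)) (π : Equiv.Perm (Fin l)) : ℤ :=
  ((l : ℤ) - numCycles π) + 2 * ((numCycles π : ℤ) - numBlocks V)

/-- The order `(V,π) ≤ (W,σ)` on partitioned permutations, i.e.
`(V,π) ⬝ (0, π⁻¹σ) = (W,σ)` (with lengths adding up). -/
def ppLe {l : ℕ} (V : Setoid (Fin l)) (π : Equiv.Perm (Fin l))
    (W : Setoid (Fin l)) (σ : Equiv.Perm (Fin l)) : Prop :=
  V ⊔ cycleSetoid (π⁻¹ * σ) = W ∧ ppLen V π + permLen (π⁻¹ * σ) = ppLen W σ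

/-- `(V,π)` and `(W,τ)` are conjugate by the permutation `σ`. -/
def ppConjBy {l : ℕ} (σ : Equiv.Perm (Fin l)) (V : Setoid (Fin l)) (π : Equiv.Perm (Fin l))
    (W : Setoid (Fin l)) (τ : Equiv.Perm (Fin l)) : Prop :=
  τ = σ * π * σ⁻¹ ∧ ∀ a b, W.r a b ↔ V.r (σ⁻¹ a) (σ⁻¹ b)

/-- `(V,π)` and `(W,τ)` are conjugate partitioned permutations. -/
def ppConj {l : ℕ} (V : Setoid (Fin l)) (π : Equiv.Perm (Fin l))
    (W : Setoid (Fin l)) (τ : Equiv.Perm (Fin l)) : Prop :=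
  ∃ σ : Equiv.Perm (Fin l), ppConjBy σ V π W τ

/-- The `(i,j)` entry of `U X U⁻¹ = U X U*` for a unitary `U` (with complex entries) and a
matrix `X` with noncommutative entries. -/
def conjEntry [Ring A] [Algebra ℂ A] {n : ℕ} (U : Matrix (Fin n) (Fin n) ℂ)
    (X : Matrix (Fin n) (Fin n) A) (i j : Fin n) : A :=
  ∑ a : Fin n, ∑ b : Fin n, (U i a * star (U j b)) • X a b

/-- A random matrix with noncommutative entries is unitarily invariant if for every unitary `U`
the joint distribution (all joint moments under `E`) of the entries of `U X U⁻¹` coincides with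
that of the entries of `X`. -/
def UnitarilyInvariant [Ring A] [Algebra ℂ A] (E : A → ℂ) {n : ℕ}
    (X : Matrix (Fin n) (Fin n) A) : Prop :=
  ∀ U ∈ Matrix.unitaryGroup (Fin n) ℂ, ∀ (m : ℕ) (i j : Fin m → Fin n),
    E (List.ofFn (fun t => conjEntry U X (i t) (j t))).prod
      = E (List.ofFn (fun t => X (i t) (j t))).prod

/-- `κ_{(V,π)} = k_V(X_{1π(1)}, …, X_{mπ(m)})`. -/
def kappa {n : ℕ} (k : ∀ {l : ℕ}, Setoid (Fin l) → (Fin l → A) → ℂ)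
    (X : Matrix (Fin n) (Fin n) A) {m : ℕ} (h : m ≤ n)
    (V : Setoid (Fin m)) (π : Equiv.Perm (Fin m)) : ℂ :=
  k V (fun t => X (Fin.castLE h t) (Fin.castLE h (π t)))

/-- The sequence `n ↦ κ_{(V,π)}(X_n)` (with junk value `0` for `n < m`). -/
def kappaSeq {A : ℕ → Type*} (k : ∀ n, ∀ {l : ℕ}, Setoid (Fin l) → (Fin l → A n) → ℂ)
    (X : ∀ n, Matrix (Fin n) (Fin n) (A n)) {m : ℕ}
    (V : Setoid (Fin m)) (π : Equiv.Perm (Fin m)) (n : ℕ) : ℂ :=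
  if h : m ≤ n then kappa (k n) (X n) h V π else 0

/-- Normalized trace of a matrix with entries in a `ℂ`-algebra. -/
def ncTrace [Ring A] [Algebra ℂ A] {n : ℕ} (X : Matrix (Fin n) (Fin n) A) : A :=
  ((n : ℂ)⁻¹) • Matrix.trace X

/-- Partial sums `p₁ + ⋯ + p_j`. -/
def psum {l : ℕ} (p : Fin l → ℕ) (j : ℕ) : ℕ := ∑ i : Fin l, if (i : ℕ) < j then p i else 0

/-- `γ` is the permutation with the cycles `(1,…,p₁)(p₁+1,…,p₁+p₂)⋯`. -/
def IsCycleType {l k : ℕ} (p : Fin l → ℕ) (γ : Equiv.Perm (Fin k)) : Prop :=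
  psum p l = k ∧
  (∀ (j : ℕ), j < l → ∀ t : Fin k, psum p j ≤ (t : ℕ) → (t : ℕ) + 1 < psum p (j + 1) →
    ((γ t : Fin k) : ℕ) = (t : ℕ) + 1) ∧
  (∀ (j : ℕ), j < l → ∀ t : Fin k, (t : ℕ) + 1 = psum p (j + 1) → ((γ t : Fin k) : ℕ) = psum p j)

/-- The section `Fin (m-1) → Fin m` merging `i` and `i+1` (both are hit by `i`). -/
def mergeEmb (m i : ℕ) (_hi : i + 1 < m) (t : Fin (m - 1)) : Fin m :=
  if (t : ℕ) ≤ i then ⟨t, by have := t.isLt; omega⟩ else ⟨(t : ℕ) + 1, by have := t.isLt; omega⟩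

/-- The partition of `{1,…,m-1}` obtained from a partition of `{1,…,m}` by merging the
elements `i` and `i+1` into a single element. -/
def mergeSetoid {m : ℕ} (W : Setoid (Fin m)) (i : ℕ) (hi : i + 1 < m) : Setoid (Fin (m - 1)) :=
  Setoid.comap (mergeEmb m i hi) W

/-- The tuple `(a₁, …, a_{i-1}, [a_i, a_{i+1}], a_{i+2}, …, a_m)` of length `m-1`. -/
def mergeSeq [Ring A] {m : ℕ} (a : Fin m → A) (i : ℕ) (hi : i + 1 < m)
    (t : Fin (m - 1)) : A :=
  if (t : ℕ) < i then a ⟨t, by have := t.isLt; omega⟩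
  else if (t : ℕ) = i then
    a ⟨i, by omega⟩ * a ⟨i + 1, hi⟩ - a ⟨i + 1, hi⟩ * a ⟨i, by omega⟩
  else a ⟨(t : ℕ) + 1, by have := t.isLt; omega⟩


/-- Extension of `a : Fin l → A` to `ℕ`, with the value `1` outside `S`. -/
def extendOne [Monoid A] {l : ℕ} (a : Fin l → A) (S : Set (Fin l)) (t : ℕ) : A :=
  if h : t < l then if (⟨t, h⟩ : Fin l) ∈ S then a ⟨t, h⟩ else 1 else 1

theorem extendOne_of_mem [Monoid A] {l : ℕ} (a : Fin l → A) {S : Set (Fin l)} {t : ℕ}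
    (h : t < l) (hS : (⟨t, h⟩ : Fin l) ∈ S) : extendOne a S t = a ⟨t, h⟩ := by
  simp [extendOne, h, hS]

theorem extendOne_of_notMem [Monoid A] {l : ℕ} (a : Fin l → A) {S : Set (Fin l)} {t : ℕ}
    (h : t < l) (hS : (⟨t, h⟩ : Fin l) ∉ S) : extendOne a S t = 1 := by
  simp [extendOne, h, hS]

theorem prod_map_filter_eq_prod_map_ite [Monoid A] {ι : Type*} (L : List ι) (p : ι → Prop)
    (a : ι → A) :
    ((L.filter (fun i => decide (p i))).map a).prod
      = (L.map (fun i => if p i then a i else 1)).prod := by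
  induction L with
  | nil => simp
  | cons x L ih => by_cases hx : p x <;> simp [hx, ih]

theorem ordProd_eq_prod_range [Monoid A] {l : ℕ} (a : Fin l → A) (S : Set (Fin l)) :
    ordProd a S = ((List.range l).map (extendOne a S)).prod := by
  rw [ordProd, prod_map_filter_eq_prod_map_ite, ← List.map_coe_finRange_eq_range, List.map_map]
  congr 2
  funext i
  simp [extendOne]

/-- Splitting an ordered product at two neighboring positions. -/
theorem prod_range_split_two [Monoid A] (f : ℕ → A) {l p q : ℕ} (h : l = p + 2 + q) :
    ((List.range l).map f).prod = ((List.range p).map f).prod * (f p * f (p + 1)) *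
      ((List.range q).map (fun j => f (p + 2 + j))).prod := by
  subst h
  simp [List.range_add, List.range_succ, Function.comp_def, mul_assoc]

/-- Splitting an ordered product at one position. -/
theorem prod_range_split_one [Monoid A] (f : ℕ → A) {l p q : ℕ} (h : l = p + 1 + q) :
    ((List.range l).map f).prod = ((List.range p).map f).prod * f p *
      ((List.range q).map (fun j => f (p + 1 + j))).prod := by
  subst h
  simp [List.range_add, List.range_succ, Function.comp_def, mul_assoc]

theorem swap_apply_of_val_ne {n i : ℕ} (hi : i + 1 < n) {t : ℕ} (ht : t < n) (h1 : t ≠ i)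
    (h2 : t ≠ i + 1) :
    Equiv.swap (⟨i, by omega⟩ : Fin n) ⟨i + 1, hi⟩ ⟨t, ht⟩ = ⟨t, ht⟩ :=
  Equiv.swap_apply_of_ne_of_ne (by simpa using h1) (by simpa using h2)

theorem ordProd_comp_swap [Monoid A] {n : ℕ} (a : Fin n → A) (i : ℕ) (hi : i + 1 < n)
    (S : Set (Fin n)) (hS : ¬ ((⟨i, by omega⟩ : Fin n) ∈ S ∧ (⟨i + 1, hi⟩ : Fin n) ∈ S)) :
    ordProd (a ∘ Equiv.swap ⟨i, by omega⟩ ⟨i + 1, hi⟩)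
      (Equiv.swap (⟨i, by omega⟩ : Fin n) ⟨i + 1, hi⟩ ⁻¹' S) = ordProd a S := by
  obtain ⟨q, hq⟩ : ∃ q, n = i + 2 + q := ⟨n - (i + 2), by omega⟩
  have hi' : i < n := by omega
  set s := Equiv.swap (⟨i, hi'⟩ : Fin n) ⟨i + 1, hi⟩ with hs
  have hne : ∀ t, t ≠ i → t ≠ i + 1 → extendOne (a ∘ s) (s ⁻¹' S) t = extendOne a S t := by
    intro t h1 h2
    by_cases ht : t < n
    · simp [extendOne, ht, hs, swap_apply_of_val_ne hi ht h1 h2]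
    · simp [extendOne, ht]
  have e1 : extendOne (a ∘ s) (s ⁻¹' S) i = extendOne a S (i + 1) := by
    simp [extendOne, hi, hi', hs]
  have e2 : extendOne (a ∘ s) (s ⁻¹' S) (i + 1) = extendOne a S i := by
    simp [extendOne, hi, hi', hs]
  have hcomm : extendOne a S (i + 1) * extendOne a S i
      = extendOne a S i * extendOne a S (i + 1) := by
    by_cases h : (⟨i, hi'⟩ : Fin n) ∈ S
    · simp [extendOne_of_notMem a hi (fun h' => hS ⟨h, h'⟩)]
    · simp [extendOne_of_notMem a hi' h]
  rw [ordProd_eq_prod_range, ordProd_eq_prod_range, prod_range_split_two _ hq,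
    prod_range_split_two _ hq, e1, e2, hcomm]
  congr 2
  · congr 1
    exact List.map_congr_left fun t ht => hne t (by have := List.mem_range.1 ht; omega)
      (by have := List.mem_range.1 ht; omega)
  · exact List.map_congr_left fun t _ => hne _ (by omega) (by omega)

theorem extendOne_mergeSeq_of_lt [Ring A] {n : ℕ} (a : Fin n → A) (i : ℕ) (hi : i + 1 < n)
    (S : Set (Fin n)) {t : ℕ} (ht : t < i) :
    extendOne (mergeSeq a i hi) (mergeEmb n i hi ⁻¹' S) t = extendOne a S t := by
  have h1 : t < n - 1 := by omega
  have h2 : t < n := by omega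
  simp [extendOne, mergeSeq, mergeEmb, h1, h2, ht, ht.le]

theorem extendOne_mergeSeq_of_gt [Ring A] {n : ℕ} (a : Fin n → A) (i : ℕ) (hi : i + 1 < n)
    (S : Set (Fin n)) {t : ℕ} (ht : i < t) :
    extendOne (mergeSeq a i hi) (mergeEmb n i hi ⁻¹' S) t = extendOne a S (t + 1) := by
  by_cases h1 : t < n - 1
  · have h2 : t + 1 < n := by omega
    simp [extendOne, mergeSeq, mergeEmb, h1, h2, ht.not_ge, ht.not_gt, ht.ne']
  · have h2 : ¬ t + 1 < n := by omega
    simp [extendOne, h1, h2]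

theorem ordProd_mergeSeq [Ring A] {n : ℕ} (a : Fin n → A) (i : ℕ) (hi : i + 1 < n)
    (S : Set (Fin n)) {q : ℕ} (hq : n = i + 2 + q) :
    ordProd (mergeSeq a i hi) (mergeEmb n i hi ⁻¹' S)
      = ((List.range i).map (extendOne a S)).prod
        * extendOne (mergeSeq a i hi) (mergeEmb n i hi ⁻¹' S) i
        * ((List.range q).map (fun j => extendOne a S (i + 2 + j))).prod := by
  rw [ordProd_eq_prod_range, prod_range_split_one _ (show n - 1 = i + 1 + q by omega)]
  congr 2
  · congr 1
    exact List.map_congr_left fun t ht =>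
      extendOne_mergeSeq_of_lt a i hi S (List.mem_range.1 ht)
  · refine List.map_congr_left fun t _ => ?_
    rw [extendOne_mergeSeq_of_gt a i hi S (by omega)]
    congr 1
    omega

theorem ordProd_mergeSeq_of_notMem [Ring A] {n : ℕ} (a : Fin n → A) (i : ℕ) (hi : i + 1 < n)
    (S : Set (Fin n)) (h1 : (⟨i, by omega⟩ : Fin n) ∉ S) (h2 : (⟨i + 1, hi⟩ : Fin n) ∉ S) :
    ordProd (mergeSeq a i hi) (mergeEmb n i hi ⁻¹' S) = ordProd a S := by
  obtain ⟨q, hq⟩ : ∃ q, n = i + 2 + q := ⟨n - (i + 2), by omega⟩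
  rw [ordProd_mergeSeq a i hi S hq, ordProd_eq_prod_range, prod_range_split_two _ hq,
    extendOne_of_notMem a _ h1, extendOne_of_notMem a _ h2,
    extendOne_of_notMem (t := i) _ (by omega) (by simpa [mergeEmb] using h1), mul_one,
    mul_one, mul_one]

theorem preimage_swap_eq {n : ℕ} (x y : Fin n) (S : Set (Fin n)) (h : x ∈ S ↔ y ∈ S) :
    Equiv.swap x y ⁻¹' S = S := by
  ext t
  rw [Set.mem_preimage, Equiv.swap_apply_def]
  split_ifs with h1 h2 <;> simp_all

theorem ordProd_sub_ordProd_comp_swap [Ring A] {n : ℕ} (a : Fin n → A) (i : ℕ) (hi : i + 1 < n)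
    (S : Set (Fin n)) (h1 : (⟨i, by omega⟩ : Fin n) ∈ S) (h2 : (⟨i + 1, hi⟩ : Fin n) ∈ S) :
    ordProd a S - ordProd (a ∘ Equiv.swap ⟨i, by omega⟩ ⟨i + 1, hi⟩) S
      = ordProd (mergeSeq a i hi) (mergeEmb n i hi ⁻¹' S) := by
  obtain ⟨q, hq⟩ : ∃ q, n = i + 2 + q := ⟨n - (i + 2), by omega⟩
  have hi' : i < n := by omega
  set s := Equiv.swap (⟨i, hi'⟩ : Fin n) ⟨i + 1, hi⟩ with hs
  have hne : ∀ t, t ≠ i → t ≠ i + 1 → extendOne (a ∘ s) S t = extendOne a S t := by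
    intro t ht1 ht2
    by_cases ht : t < n
    · simp [extendOne, ht, hs, swap_apply_of_val_ne hi ht ht1 ht2]
    · simp [extendOne, ht]
  have hl : (List.range i).map (extendOne (a ∘ s) S) = (List.range i).map (extendOne a S) :=
    List.map_congr_left fun t ht => hne t (by have := List.mem_range.1 ht; omega)
      (by have := List.mem_range.1 ht; omega)
  have hr : (List.range q).map (fun j => extendOne (a ∘ s) S (i + 2 + j))
      = (List.range q).map (fun j => extendOne a S (i + 2 + j)) :=
    List.map_congr_left fun t _ => hne _ (by omega) (by omega)
  rw [ordProd_mergeSeq a i hi S hq, ordProd_eq_prod_range, ordProd_eq_prod_range,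
    prod_range_split_two _ hq, prod_range_split_two _ hq, hl, hr,
    extendOne_of_mem a hi' h1, extendOne_of_mem a hi h2, extendOne_of_mem (a ∘ s) hi' h1,
    extendOne_of_mem (a ∘ s) hi h2,
    extendOne_of_mem (t := i) _ (by omega) (by simpa [mergeEmb] using h1)]
  simp [mergeSeq, hs, mul_sub, sub_mul]

theorem momentV_eq_prod_quotient {R : Type*} [CommRing R] [Monoid A] {l : ℕ} (E : A → R)
    (V : Setoid (Fin l)) (a : Fin l → A) :
    momentV E V a = ∏ q : Quotient V, E (ordProd a {x | Quotient.mk V x = q}) := by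
  rw [momentV, ← finprod_set_coe_eq_finprod_mem, ← finprod_eq_prod_of_fintype]
  refine (finprod_eq_of_bijective _ (Setoid.quotientEquivClasses V).bijective fun q => ?_).symm
  induction q using Quotient.inductionOn with
  | h x =>
    rw [Setoid.quotientEquivClasses_mk_eq]
    congr 2
    ext y
    exact Quotient.eq

theorem momentV_comap_swap {R : Type*} [CommRing R] [Monoid A] {n : ℕ} (E : A → R)
    (a : Fin n → A) (i : ℕ) (hi : i + 1 < n) (V : Setoid (Fin n))
    (hV : ¬ V.r ⟨i, by omega⟩ ⟨i + 1, hi⟩) :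
    momentV E (Setoid.comap (Equiv.swap ⟨i, by omega⟩ ⟨i + 1, hi⟩) V)
      (a ∘ Equiv.swap ⟨i, by omega⟩ ⟨i + 1, hi⟩) = momentV E V a := by
  set s := Equiv.swap (⟨i, by omega⟩ : Fin n) ⟨i + 1, hi⟩ with hs
  rw [momentV_eq_prod_quotient, momentV_eq_prod_quotient]
  refine Fintype.prod_equiv (Quotient.congr s fun _ _ => Iff.rfl) _ _ fun q => ?_
  induction q using Quotient.inductionOn with
  | h x =>
    rw [← ordProd_comp_swap a i hi]
    · congr 2
      ext y
      exact Quotient.eq.trans (Quotient.eq (r := V) (x := s y) (y := s x)).symm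
    · rintro ⟨h1, h2⟩
      exact hV (Quotient.exact (h1.trans h2.symm))

/-- The surjection `Fin m → Fin (m - 1)` identifying `i` and `i + 1`. -/
def collapse (m i : ℕ) (hi : i + 1 < m) (t : Fin m) : Fin (m - 1) :=
  if h : (t : ℕ) ≤ i then ⟨t, by omega⟩ else ⟨(t : ℕ) - 1, by have := t.isLt; omega⟩

theorem collapse_mergeEmb {m i : ℕ} (hi : i + 1 < m) (t : Fin (m - 1)) :
    collapse m i hi (mergeEmb m i hi t) = t := by
  rcases le_or_gt (t : ℕ) i with h | h
  · simp [collapse, mergeEmb, h]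
  · simp [collapse, mergeEmb, h.not_ge, show ¬ (t : ℕ) + 1 ≤ i by omega]

theorem rel_mergeEmb_collapse {m i : ℕ} (hi : i + 1 < m) (W : Setoid (Fin m))
    (hW : W.r ⟨i, by omega⟩ ⟨i + 1, hi⟩) (t : Fin m) :
    W (mergeEmb m i hi (collapse m i hi t)) t := by
  by_cases h : (t : ℕ) = i + 1
  · have ht : t = ⟨i + 1, hi⟩ := Fin.ext h
    subst ht
    simpa [collapse, mergeEmb] using hW
  · have : mergeEmb m i hi (collapse m i hi t) = t := by
      unfold collapse mergeEmb
      ext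
      split_ifs <;> simp_all <;> omega
    rw [this]

theorem collapse_eq_collapse {m i : ℕ} (hi : i + 1 < m) :
    collapse m i hi ⟨i, by omega⟩ = collapse m i hi ⟨i + 1, hi⟩ := by
  simp [collapse]

theorem comap_collapse_mergeSetoid {m i : ℕ} (hi : i + 1 < m) (W : Setoid (Fin m))
    (hW : W.r ⟨i, by omega⟩ ⟨i + 1, hi⟩) :
    Setoid.comap (collapse m i hi) (mergeSetoid W i hi) = W := by
  ext x y
  have hx := rel_mergeEmb_collapse hi W hW x
  have hy := rel_mergeEmb_collapse hi W hW y
  exact ⟨fun h => W.trans (W.symm hx) (W.trans h hy),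
    fun h => W.trans hx (W.trans h (W.symm hy))⟩

theorem mergeSetoid_comap_collapse {m i : ℕ} (hi : i + 1 < m) (U : Setoid (Fin (m - 1))) :
    mergeSetoid (Setoid.comap (collapse m i hi) U) i hi = U := by
  ext x y
  change U (collapse m i hi (mergeEmb m i hi x)) (collapse m i hi (mergeEmb m i hi y)) ↔ _
  rw [collapse_mergeEmb, collapse_mergeEmb]

theorem momentV_sub_momentV_comp_swap [Ring A] {R F : Type*} [CommRing R] [FunLike F A R]
    [AddMonoidHomClass F A R] {n : ℕ} (E : F) (a : Fin n → A) (i : ℕ) (hi : i + 1 < n)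
    (V : Setoid (Fin n)) (hV : V.r ⟨i, by omega⟩ ⟨i + 1, hi⟩) :
    momentV E V a - momentV E V (a ∘ Equiv.swap ⟨i, by omega⟩ ⟨i + 1, hi⟩)
      = momentV E (mergeSetoid V i hi) (mergeSeq a i hi) := by
  have hi' : i < n := by omega
  have hq : Quotient.mk V ⟨i, hi'⟩ = Quotient.mk V ⟨i + 1, hi⟩ := Quotient.sound hV
  have hmerge : momentV E (mergeSetoid V i hi) (mergeSeq a i hi)
      = ∏ q : Quotient V, E (ordProd (mergeSeq a i hi)
          (mergeEmb n i hi ⁻¹' {x | Quotient.mk V x = q})) := by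
    rw [momentV_eq_prod_quotient]
    refine Fintype.prod_bijective
      (Quotient.map (mergeEmb n i hi) fun _ _ h => h) ⟨?_, ?_⟩ _ _ fun q => ?_
    · intro p q
      induction p, q using Quotient.inductionOn₂ with
      | h x y => exact fun h => Quotient.sound (Quotient.exact (s := V) (a := mergeEmb n i hi x)
          (b := mergeEmb n i hi y) h)
    · intro q
      induction q using Quotient.inductionOn with
      | h x => exact ⟨Quotient.mk _ (collapse n i hi x),
          Quotient.sound (rel_mergeEmb_collapse hi V hV x)⟩
    · induction q using Quotient.inductionOn with
      | h x =>
        congr 2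
        ext y
        exact Quotient.eq.trans
          (Quotient.eq (r := V) (x := mergeEmb n i hi y) (y := mergeEmb n i hi x)).symm
  rw [hmerge, momentV_eq_prod_quotient, momentV_eq_prod_quotient, sub_eq_iff_eq_add]
  refine (Finset.prod_add_prod_eq (Finset.mem_univ (Quotient.mk V ⟨i, hi'⟩)) ?_ ?_ ?_).symm
  · rw [← map_add, ← ordProd_sub_ordProd_comp_swap a i hi
      {x | Quotient.mk V x = Quotient.mk V ⟨i, hi'⟩} rfl hq.symm, sub_add_cancel]
  · intro q _ hne
    rw [ordProd_mergeSeq_of_notMem a i hi _ (fun h => hne h.symm)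
      (fun h => hne (h.symm.trans hq.symm))]
  · intro q _ hne
    have h1 : (⟨i, hi'⟩ : Fin n) ∉ {x | Quotient.mk V x = q} := fun h => hne h.symm
    have h2 : (⟨i + 1, hi⟩ : Fin n) ∉ {x | Quotient.mk V x = q} :=
      fun h => hne (h.symm.trans hq.symm)
    rw [← ordProd_comp_swap a i hi _ (fun h => h1 h.1), preimage_swap_eq _ _ _ (by simp [h1, h2])]

/-- Functions on a finite partial order are determined on a subset by their sums over the
intersections of principal lower sets with that subset. -/
theorem eq_of_sum_le_eq {P R : Type*} [PartialOrder P] [Fintype P] [AddCommGroup R]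
    (p : P → Prop) [DecidablePred p] (f g : P → R)
    (h : ∀ V, p V → ∑ W ∈ Finset.univ.filter (fun W => W ≤ V ∧ p W), f W
      = ∑ W ∈ Finset.univ.filter (fun W => W ≤ V ∧ p W), g W) (V : P) (hV : p V) :
    f V = g V := by
  induction V using WellFoundedLT.induction with
  | ind V ih =>
    have hmem : V ∈ Finset.univ.filter (fun W => W ≤ V ∧ p W) := by simp [hV]
    have := h V hV
    rw [← Finset.add_sum_erase _ f hmem, ← Finset.add_sum_erase _ g hmem,
      Finset.sum_congr rfl fun W hW => ?_] at this
    · exact add_right_cancel this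
    · simp only [Finset.mem_erase, Finset.mem_filter, Finset.mem_univ, true_and] at hW
      exact ih W (lt_of_le_of_ne hW.2.1 hW.1) hW.2.2

theorem comap_swap_comap_swap {n : ℕ} (x y : Fin n) (W : Setoid (Fin n)) :
    Setoid.comap (Equiv.swap x y) (Setoid.comap (Equiv.swap x y) W) = W := by
  ext u v
  simp [Setoid.comap_rel]

theorem comap_mono {α β : Type*} (f : α → β) {V W : Setoid β} (h : V ≤ W) :
    Setoid.comap f V ≤ Setoid.comap f W :=
  fun _ _ hxy => h hxy

theorem comap_swap_of_rel {n : ℕ} {x y : Fin n} (V : Setoid (Fin n)) (h : V x y) :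
    Setoid.comap (Equiv.swap x y) V = V := by
  have key : ∀ t, V (Equiv.swap x y t) t := by
    intro t
    rw [Equiv.swap_apply_def]
    split_ifs with h1 h2
    · exact h1 ▸ V.symm h
    · exact h2 ▸ h
    · exact V.refl t
  ext u v
  exact ⟨fun huv => V.trans (V.symm (key u)) (V.trans huv (key v)),
    fun huv => V.trans (key u) (V.trans huv (V.symm (key v)))⟩

theorem rel_comap_swap_iff {n : ℕ} (x y : Fin n) (W : Setoid (Fin n)) :
    Setoid.comap (Equiv.swap x y) W x y ↔ W x y := by
  simp [Setoid.comap_rel, W.comm']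

theorem IsCumulant.apply_comap_swap {R : Type*} [CommRing R] [Monoid A] {E : A → R}
    {k : ∀ {l : ℕ}, Setoid (Fin l) → (Fin l → A) → R} (hk : IsCumulant E @k)
    {n : ℕ} (a : Fin n → A) (i : ℕ) (hi : i + 1 < n) (V : Setoid (Fin n))
    (hV : ¬ V.r ⟨i, by omega⟩ ⟨i + 1, hi⟩) :
    k (Setoid.comap (Equiv.swap ⟨i, by omega⟩ ⟨i + 1, hi⟩) V)
      (a ∘ Equiv.swap ⟨i, by omega⟩ ⟨i + 1, hi⟩) = k V a := by
  set x : Fin n := ⟨i, by omega⟩ with hx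
  set y : Fin n := ⟨i + 1, hi⟩ with hy
  refine eq_of_sum_le_eq (fun W : Setoid (Fin n) => ¬ W x y)
    (fun W => k (Setoid.comap (Equiv.swap x y) W) (a ∘ Equiv.swap x y)) (fun W => k W a)
    (fun V hV => ?_) V hV
  have hfilter : Finset.univ.filter (fun W : Setoid (Fin n) => W ≤ V ∧ ¬ W x y)
      = Finset.univ.filter (fun W : Setoid (Fin n) => W ≤ V) :=
    Finset.filter_congr fun W _ => ⟨fun h => h.1, fun h => ⟨h, fun hW => hV (h hW)⟩⟩
  rw [hfilter, hk, ← momentV_comap_swap E a i hi V hV, ← hk]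
  refine Finset.sum_nbij' (Setoid.comap (Equiv.swap x y)) (Setoid.comap (Equiv.swap x y))
    ?_ ?_ ?_ ?_ ?_
  · intro W hW
    simpa using comap_mono _ (Finset.mem_filter.1 hW).2
  · intro W hW
    have := comap_mono (Equiv.swap x y) (Finset.mem_filter.1 hW).2
    rw [comap_swap_comap_swap] at this
    simpa using this
  · exact fun W _ => comap_swap_comap_swap x y W
  · exact fun W _ => comap_swap_comap_swap x y W
  · exact fun W _ => rfl

open scoped ComplexOrder in
/-- For tensor cumulants, swapping two neighboring arguments lying in the same
block of `W` changes the cumulant by the cumulant (over the merged partition) of the tuple with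
the two arguments replaced by their commutator. -/
theorem cumulants_and_commutators
    {A : Type*} [Ring A] [Algebra ℂ A] [StarRing A]
    (E : A →ₗ[ℂ] ℂ) (hE1 : E 1 = 1) (hEpos : ∀ x : A, x ≠ 0 → 0 < E (star x * x))
    (k : ∀ {l : ℕ}, Setoid (Fin l) → (Fin l → A) → ℂ) (hk : IsCumulant (⇑E) @k)
    {n : ℕ} (a : Fin n → A) (i : ℕ) (hi : i + 1 < n)
    (W : Setoid (Fin n)) (hW : W.r ⟨i, by omega⟩ ⟨i + 1, hi⟩) :
    k W a - k W (a ∘ Equiv.swap ⟨i, by omega⟩ ⟨i + 1, hi⟩)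
      = k (mergeSetoid W i hi) (mergeSeq a i hi) := by
  set x : Fin n := ⟨i, by omega⟩ with hx
  set y : Fin n := ⟨i + 1, hi⟩ with hy
  refine eq_of_sum_le_eq (fun W : Setoid (Fin n) => W x y)
    (fun W => k W a - k W (a ∘ Equiv.swap x y))
    (fun W => k (mergeSetoid W i hi) (mergeSeq a i hi)) (fun V hV => ?_) W hW
  have hcancel : ∑ W ∈ Finset.univ.filter (fun W : Setoid (Fin n) => W ≤ V ∧ ¬ W x y), k W a
      = ∑ W ∈ Finset.univ.filter (fun W : Setoid (Fin n) => W ≤ V ∧ ¬ W x y),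
          k W (a ∘ Equiv.swap x y) := by
    have hmaps : ∀ W ∈ Finset.univ.filter (fun W : Setoid (Fin n) => W ≤ V ∧ ¬ W x y),
        Setoid.comap (Equiv.swap x y) W
          ∈ Finset.univ.filter (fun W : Setoid (Fin n) => W ≤ V ∧ ¬ W x y) := by
      intro W hW
      simp only [Finset.mem_filter, Finset.mem_univ, true_and] at hW ⊢
      refine ⟨?_, fun h => hW.2 ((rel_comap_swap_iff x y W).1 h)⟩
      simpa only [comap_swap_of_rel V hV] using comap_mono (Equiv.swap x y) hW.1
    refine Finset.sum_nbij' (Setoid.comap (Equiv.swap x y)) (Setoid.comap (Equiv.swap x y))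
      hmaps hmaps (fun W _ => comap_swap_comap_swap x y W)
      (fun W _ => comap_swap_comap_swap x y W) fun W hW => ?_
    exact (hk.apply_comap_swap a i hi W (Finset.mem_filter.1 hW).2.2).symm
  have hsplit : ∀ b : Fin n → A,
      ∑ W ∈ Finset.univ.filter (fun W : Setoid (Fin n) => W ≤ V ∧ W x y), k W b
        + ∑ W ∈ Finset.univ.filter (fun W : Setoid (Fin n) => W ≤ V ∧ ¬ W x y), k W b
        = momentV E V b := by
    intro b
    rw [← hk, ← Finset.sum_filter_add_sum_filter_not
      (Finset.univ.filter (fun W : Setoid (Fin n) => W ≤ V)) (fun W => W x y),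
      Finset.filter_filter, Finset.filter_filter]
  have hmerge : ∑ W ∈ Finset.univ.filter (fun W : Setoid (Fin n) => W ≤ V ∧ W x y),
      k (mergeSetoid W i hi) (mergeSeq a i hi)
        = momentV E (mergeSetoid V i hi) (mergeSeq a i hi) := by
    rw [← hk]
    refine Finset.sum_nbij' (fun W => mergeSetoid W i hi) (Setoid.comap (collapse n i hi))
      ?_ ?_ ?_ ?_ fun _ _ => rfl
    · exact fun W hW => Finset.mem_filter.2
        ⟨Finset.mem_univ _, comap_mono (mergeEmb n i hi) (Finset.mem_filter.1 hW).2.1⟩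
    · intro U hU
      simp only [Finset.mem_filter, Finset.mem_univ, true_and] at hU ⊢
      constructor
      · simpa only [comap_collapse_mergeSetoid hi V hV] using comap_mono (collapse n i hi) hU
      · rw [Setoid.comap_rel, hx, hy, collapse_eq_collapse hi]
    · exact fun W hW => comap_collapse_mergeSetoid hi W (Finset.mem_filter.1 hW).2.2
    · exact fun U _ => mergeSetoid_comap_collapse hi U
  rw [hmerge, ← momentV_sub_momentV_comp_swap E a i hi V hV, ← hsplit, ← hsplit, hcancel,
    Finset.sum_sub_distrib, add_sub_add_right_eq_sub]

end HOF
end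
end

section
/- Let X = (X_{ij}) be a unitarily invariant n×n random matrix with noncommutative entries over a noncommutative probability space (A,E). Then for each integer 1 ≤ k ≤ n and each partition V of {1,…,k} there exists a unique function (V,π) ↦ κ_{(V,π)} ∈ ℂ, defined on permutations π ∈ S_k, such that for all indices i₁,…,i_k, j₁,…,j_k ∈ {1,…,n}: k_V(X_{i₁j₁},…,X_{i_kj_k}) = Σ_{π ∈ S_k} [j₁ = i_{π(1)}]⋯[j_k = i_{π(k)}]·κ_{(V,π)}, and such that κ_{(V,π)} ≠ 0 only if π ≤ V (every cycle of π lies in a block of V). Explicitly, κ_{(V,π)} = k_V(X_{1π(1)},…,X_{kπ(k)}). -/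
open scoped Classical BigOperators
open Filter

noncomputable section

namespace HOF

variable {A : Type*}

section Multilinearity

/-- `f` is linear in each of its arguments separately. -/
def SeparatelyLinear {ι M : Type*} [DecidableEq ι] [AddCommGroup M] [Module ℂ M]
    (f : (ι → M) → ℂ) : Prop :=
  ∀ (a : ι → M) (s : ι), IsLinearMap ℂ (fun x => f (Function.update a s x))

theorem SeparatelyLinear.map_sum_smul {ι β M : Type*} [DecidableEq ι] [Fintype ι] [Fintype β]
    [AddCommGroup M] [Module ℂ M] {f : (ι → M) → ℂ} (hf : SeparatelyLinear f)
    (c : ι → β → ℂ) (Y : β → M) :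
    f (fun t => ∑ p, c t p • Y p) = ∑ q : ι → β, (∏ t, c t (q t)) * f (fun t => Y (q t)) := by
  let F : MultilinearMap ℂ (fun _ : ι => M) ℂ := MultilinearMap.mk' f
    (fun a s x y => (hf a s).map_add x y) (fun a s c x => (hf a s).map_smul c x)
  have h := F.map_sum (fun t p => c t p • Y p)
  refine h.trans (Finset.sum_congr rfl fun q _ => ?_)
  exact F.map_smul_univ (fun t => c t (q t)) (fun t => Y (q t))

theorem map_update_of_notMem {ι M : Type*} [DecidableEq ι] (a : ι → M) {s : ι} (x : M)
    {L : List ι} (hs : s ∉ L) : L.map (Function.update a s x) = L.map a :=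
  List.map_congr_left fun _ ht => Function.update_of_ne (ne_of_mem_of_not_mem ht hs) _ _

theorem isLinearMap_prod_map_update [Ring A] [Algebra ℂ A] {ι : Type*} [DecidableEq ι] (a : ι → A)
    (s : ι) {L : List ι} (hL : L.Nodup) (hs : s ∈ L) :
    IsLinearMap ℂ (fun x => (L.map (Function.update a s x)).prod) := by
  obtain ⟨L₁, L₂, rfl⟩ := List.append_of_mem hs
  have hs' := List.nodup_middle.1 hL
  simp only [List.nodup_cons, List.mem_append, not_or] at hs'
  simp only [List.map_append, List.map_cons, List.prod_append, List.prod_cons,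
    map_update_of_notMem a _ hs'.1.1, map_update_of_notMem a _ hs'.1.2, Function.update_self]
  constructor
  · intro x y
    simp only [add_mul, mul_add]
  · intro c x
    simp only [smul_mul_assoc, mul_smul_comm]

theorem ordProd_update_of_notMem [Monoid A] {l : ℕ} (a : Fin l → A) {s : Fin l} (x : A)
    {S : Set (Fin l)} (hs : s ∉ S) : ordProd (Function.update a s x) S = ordProd a S := by
  unfold ordProd
  rw [map_update_of_notMem]
  simpa using hs

theorem momentV_eq_prod [Monoid A] {R : Type*} [CommRing R] {l : ℕ} (E : A → R)
    (V : Setoid (Fin l)) (a : Fin l → A) :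
    momentV E V a = ∏ B ∈ (Set.toFinite (Setoid.classes V)).toFinset, E (ordProd a B) :=
  finprod_mem_eq_finite_toFinset_prod _ _

theorem separatelyLinear_momentV [Ring A] [Algebra ℂ A] (E : A →ₗ[ℂ] ℂ) {l : ℕ}
    (V : Setoid (Fin l)) : SeparatelyLinear (momentV (⇑E) V) := by
  intro a s
  have hB : {t | V t s} ∈ (Set.toFinite (Setoid.classes V)).toFinset := by
    simpa using Setoid.mem_classes V s
  have key : ∀ x, momentV (⇑E) V (Function.update a s x)
      = E (ordProd (Function.update a s x) {t | V t s})
        * ∏ B ∈ (Set.toFinite (Setoid.classes V)).toFinset.erase {t | V t s},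
            E (ordProd a B) := by
    intro x
    rw [momentV_eq_prod, ← Finset.mul_prod_erase _ _ hB]
    congr 1
    refine Finset.prod_congr rfl fun B hB' => ?_
    rw [ordProd_update_of_notMem]
    intro hs
    rw [Finset.mem_erase] at hB'
    have hB'' : B ∈ Setoid.classes V := by simpa using hB'.2
    exact hB'.1 (Setoid.eq_of_mem_classes hB'' hs (Setoid.mem_classes V s) (V.refl s))
  have hlin : IsLinearMap ℂ (fun x => ordProd (Function.update a s x) {t | V t s}) := by
    refine isLinearMap_prod_map_update a s ((List.nodup_finRange l).filter _) ?_
    simp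
  constructor
  · intro x y
    simp only [key, hlin.map_add, map_add, add_mul]
  · intro c x
    simp only [key, hlin.map_smul, map_smul, smul_eq_mul, mul_assoc]

variable {R : Type*} [CommRing R]

theorem IsCumulant.eq_sub [Monoid A] {E : A → R}
    {k : ∀ {l : ℕ}, Setoid (Fin l) → (Fin l → A) → R} (hk : IsCumulant E @k) {l : ℕ}
    (V : Setoid (Fin l)) (a : Fin l → A) :
    k V a = momentV E V a
      - ∑ W ∈ Finset.univ.filter (fun W : Setoid (Fin l) => W < V), k W a := by
  rw [← hk l V a]
  have : Finset.univ.filter (fun W : Setoid (Fin l) => W ≤ V)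
      = insert V (Finset.univ.filter (fun W : Setoid (Fin l) => W < V)) := by
    ext W
    simp [le_iff_eq_or_lt]
  rw [this, Finset.sum_insert (by simp)]
  ring

theorem IsCumulant.separatelyLinear [Ring A] [Algebra ℂ A] {E : A →ₗ[ℂ] ℂ}
    {k : ∀ {l : ℕ}, Setoid (Fin l) → (Fin l → A) → ℂ} (hk : IsCumulant (⇑E) @k) {l : ℕ}
    (V : Setoid (Fin l)) : SeparatelyLinear (k V) := by
  induction V using WellFoundedLT.induction with
  | ind V ih =>
  intro a s
  have hV := separatelyLinear_momentV E V a s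
  constructor
  · intro x y
    simp only [hk.eq_sub V, hV.map_add]
    rw [Finset.sum_congr rfl fun W hW => (ih W (by simpa using hW) a s).map_add x y,
      Finset.sum_add_distrib]
    ring
  · intro c x
    simp only [hk.eq_sub V, hV.map_smul]
    rw [Finset.sum_congr rfl fun W hW => (ih W (by simpa using hW) a s).map_smul c x,
      ← Finset.smul_sum, smul_sub]

theorem IsCumulant.congr_of_momentV [Monoid A] {E : A → R}
    {k : ∀ {l : ℕ}, Setoid (Fin l) → (Fin l → A) → R} (hk : IsCumulant E @k) {l : ℕ}
    {a b : Fin l → A} (hab : ∀ W, momentV E W a = momentV E W b) (V : Setoid (Fin l)) :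
    k V a = k V b := by
  induction V using WellFoundedLT.induction with
  | ind V ih =>
  rw [hk.eq_sub V a, hk.eq_sub V b, hab V,
    Finset.sum_congr rfl fun W hW => ih W (by simpa using hW)]

theorem IsCumulant.eq_zero_of_momentV [Monoid A] {E : A → R}
    {k : ∀ {l : ℕ}, Setoid (Fin l) → (Fin l → A) → R} (hk : IsCumulant E @k) {l : ℕ}
    {a : Fin l → A} {V : Setoid (Fin l)} (ha : ∀ W ≤ V, momentV E W a = 0) :
    k V a = 0 := by
  induction V using WellFoundedLT.induction with
  | ind V ih =>
  rw [hk.eq_sub V a, ha V le_rfl, zero_sub, neg_eq_zero]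
  refine Finset.sum_eq_zero fun W hW => ?_
  have hWV : W < V := by simpa using hW
  exact ih W hWV fun W' hW' => ha W' (hW'.trans hWV.le)

end Multilinearity

theorem prod_map_smul [Ring A] [Algebra ℂ A] {ι : Type*} (c : ι → ℂ) (f : ι → A)
    (L : List ι) : (L.map fun s => c s • f s).prod = (L.map c).prod • (L.map f).prod := by
  induction L with
  | nil => simp
  | cons s L ih => simp [ih, smul_smul, mul_comm (c s)]

/-- The matrix of `U ⊗ ⋯ ⊗ U`. -/
def tensorPow {n : ℕ} (m : ℕ) (U : Matrix (Fin n) (Fin n) ℂ) :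
    Matrix (Fin m → Fin n) (Fin m → Fin n) ℂ :=
  Matrix.of fun i a => ∏ t, U (i t) (a t)

theorem conjTranspose_tensorPow_mul {n : ℕ} (m : ℕ) {U : Matrix (Fin n) (Fin n) ℂ}
    (hU : U ∈ Matrix.unitaryGroup (Fin n) ℂ) :
    (tensorPow m U).conjTranspose * tensorPow m U = 1 := by
  have hU' : ∀ a b, ∑ c, star (U c a) * U c b = if a = b then 1 else 0 := by
    intro a b
    have := congrFun (congrFun (Matrix.mem_unitaryGroup_iff'.1 hU) a) b
    rw [Matrix.mul_apply, Matrix.one_apply] at this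
    simpa [Matrix.star_apply] using this
  ext i j
  rw [Matrix.mul_apply, Matrix.one_apply]
  simp only [tensorPow, Matrix.conjTranspose_apply, Matrix.of_apply, star_prod,
    ← Finset.prod_mul_distrib]
  have h := Finset.prod_univ_sum (fun _ : Fin m => (Finset.univ : Finset (Fin n)))
    (fun t c => star (U c (i t)) * U c (j t))
  rw [Fintype.piFinset_univ] at h
  rw [← h]
  simp only [hU', Finset.prod_ite_zero, Finset.mem_univ, true_implies, Finset.prod_const_one,
    funext_iff]

theorem tensorPow_diagonal {n : ℕ} (m : ℕ) (d : Fin n → ℂ) :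
    tensorPow m (Matrix.diagonal d) = Matrix.diagonal fun i => ∏ t, d (i t) := by
  ext i j
  simp only [tensorPow, Matrix.of_apply, Matrix.diagonal_apply, Finset.prod_ite_zero,
    Finset.mem_univ, true_implies, funext_iff]

theorem diagonal_mem_unitaryGroup {n : ℕ} {d : Fin n → ℂ} (hd : ∀ x, d x * star (d x) = 1) :
    Matrix.diagonal d ∈ Matrix.unitaryGroup (Fin n) ℂ := by
  rw [Matrix.mem_unitaryGroup_iff, Matrix.star_eq_conjTranspose, Matrix.diagonal_conjTranspose,
    Matrix.diagonal_mul_diagonal]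
  simp only [Pi.star_apply, hd, Matrix.diagonal_one]

/-- The Householder reflection along `e_a + 2 e_v`. -/
def reflection {n : ℕ} (a v : Fin n) : Matrix (Fin n) (Fin n) ℂ :=
  1 - (2 / 5 : ℂ) • Matrix.vecMulVec (Pi.single a 1 + Pi.single v 2)
    (Pi.single a 1 + Pi.single v 2)

theorem reflection_mem_unitaryGroup {n : ℕ} {a v : Fin n} (hav : a ≠ v) :
    reflection a v ∈ Matrix.unitaryGroup (Fin n) ℂ := by
  set w : Fin n → ℂ := Pi.single a 1 + Pi.single v 2 with hw
  have hstar : star w = w := by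
    ext x
    by_cases hx : x = v <;> simp [hw, Pi.single_apply, apply_ite (starRingEnd ℂ), hx]
  have hww : w ⬝ᵥ w = 5 := by
    simp [hw, hav, hav.symm]
    norm_num
  have hsq : Matrix.vecMulVec w w * Matrix.vecMulVec w w = (5 : ℂ) • Matrix.vecMulVec w w := by
    rw [Matrix.vecMulVec_mul_vecMulVec, hww]
    ext x y
    simp [Matrix.vecMulVec_apply]
    ring
  have hherm : star (reflection a v) = reflection a v := by
    rw [Matrix.star_eq_conjTranspose, reflection, Matrix.conjTranspose_sub,
      Matrix.conjTranspose_smul, Matrix.conjTranspose_vecMulVec, ← hw, hstar]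
    simp
  rw [Matrix.mem_unitaryGroup_iff, hherm, reflection, ← hw, sub_mul, mul_sub, mul_sub,
    smul_mul_smul_comm, hsq]
  simp only [mul_one, one_mul, smul_smul]
  module

theorem reflection_apply {n : ℕ} (a v x y : Fin n) :
    reflection a v x y = (if x = y then 1 else 0) - 2 / 5 *
      (((if x = a then 1 else 0) + if x = v then 2 else 0) *
        ((if y = a then 1 else 0) + if y = v then 2 else 0)) := by
  simp [reflection, Matrix.one_apply, Matrix.vecMulVec_apply, Pi.single_apply]

theorem reflection_apply_ne_zero {n : ℕ} {a v : Fin n} (hav : a ≠ v) :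
    reflection a v a v ≠ 0 ∧ ∀ x, reflection a v x x ≠ 0 := by
  constructor
  · simp [reflection_apply, hav, hav.symm]
  · intro x
    by_cases hxa : x = a
    · subst hxa
      simp [reflection_apply, hav]
      norm_num
    · by_cases hxv : x = v
      · subst hxv
        simp [reflection_apply, hxa]
        norm_num
      · simp [reflection_apply, hxa, hxv]

theorem eq_or_of_reflection_apply_ne_zero {n : ℕ} {a v x y : Fin n}
    (h : reflection a v x y ≠ 0) : x = y ∨ ((x = a ∨ x = v) ∧ (y = a ∨ y = v)) := by
  by_contra! hxy
  apply h
  rw [reflection_apply, if_neg hxy.1]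
  by_cases hx : x = a ∨ x = v
  · simp [hxy.2 hx]
  · rw [not_or] at hx
    simp [hx]

/-- The matrix of a permutation of the standard basis. -/
def basisPerm {n : ℕ} (σ : Equiv.Perm (Fin n)) : Matrix (Fin n) (Fin n) ℂ :=
  Matrix.of fun x y => if x = σ y then 1 else 0

theorem basisPerm_mem_unitaryGroup {n : ℕ} (σ : Equiv.Perm (Fin n)) :
    basisPerm σ ∈ Matrix.unitaryGroup (Fin n) ℂ := by
  rw [Matrix.mem_unitaryGroup_iff']
  ext x y
  simp [basisPerm, Matrix.mul_apply, Matrix.star_apply, Matrix.one_apply, eq_comm]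

theorem tensorPow_basisPerm_apply {n : ℕ} (m : ℕ) (σ : Equiv.Perm (Fin n))
    (i a : Fin m → Fin n) :
    tensorPow m (basisPerm σ) i a = if i = σ ∘ a then 1 else 0 := by
  simp only [tensorPow, basisPerm, Matrix.of_apply, Finset.prod_ite_zero,
    Finset.mem_univ, true_implies, funext_iff, Finset.prod_const_one, Function.comp_apply]

section Commutant

variable {m n : ℕ} {S : Matrix (Fin m → Fin n) (Fin m → Fin n) ℂ}

theorem card_fiber_eq_of_commute
    (hS : ∀ U ∈ Matrix.unitaryGroup (Fin n) ℂ, Commute S (tensorPow m U))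
    {i j : Fin m → Fin n} (hij : S i j ≠ 0) (x : Fin n) :
    (Finset.univ.filter fun t => i t = x).card = (Finset.univ.filter fun t => j t = x).card := by
  have hz := Complex.isPrimitiveRoot_exp (m + 1) m.succ_ne_zero
  set z := Complex.exp (2 * Real.pi * Complex.I / ((m + 1 : ℕ) : ℂ)) with hzdef
  have hzz : z * star z = 1 := by
    have hnorm : ‖z‖ = 1 := hz.norm'_eq_one m.succ_ne_zero
    rw [Complex.star_def, Complex.mul_conj, Complex.normSq_eq_norm_sq, hnorm]
    simp
  let d : Fin n → ℂ := fun y => if y = x then z else 1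
  have hd : ∀ y, d y * star (d y) = 1 := by
    intro y
    by_cases hy : y = x
    · simpa [d, hy] using hzz
    · simp [d, hy]
  have hprod : ∀ f : Fin m → Fin n,
      ∏ t, d (f t) = z ^ (Finset.univ.filter fun t => f t = x).card := by
    intro f
    simp [d, Finset.prod_ite]
  have h := congrFun (congrFun (hS _ (diagonal_mem_unitaryGroup hd)).eq i) j
  rw [tensorPow_diagonal, Matrix.mul_diagonal, Matrix.diagonal_mul, hprod, hprod, mul_comm] at h
  have hcard : ∀ f : Fin m → Fin n, (Finset.univ.filter fun t => f t = x).card < m + 1 := by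
    intro f
    have := Finset.card_le_univ (Finset.univ.filter fun t => f t = x)
    rw [Fintype.card_fin] at this
    omega
  exact (hz.pow_inj (hcard j) (hcard i) (mul_right_cancel₀ hij h)).symm

theorem apply_comp_of_commute
    (hS : ∀ U ∈ Matrix.unitaryGroup (Fin n) ℂ, Commute S (tensorPow m U))
    (σ : Equiv.Perm (Fin n)) (i j : Fin m → Fin n) : S (σ ∘ i) (σ ∘ j) = S i j := by
  have h := congrFun (congrFun (hS _ (basisPerm_mem_unitaryGroup σ)).eq (σ ∘ i)) j
  simp only [Matrix.mul_apply, tensorPow_basisPerm_apply] at h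
  simpa [σ.injective.comp_left.eq_iff] using h

theorem apply_eq_zero_of_injective
    (hS : ∀ U ∈ Matrix.unitaryGroup (Fin n) ℂ, Commute S (tensorPow m U)) (hmn : m ≤ n)
    (h0 : ∀ π : Equiv.Perm (Fin m), S (Fin.castLE hmn) (Fin.castLE hmn ∘ π) = 0)
    {i : Fin m → Fin n} (hi : Function.Injective i) (j : Fin m → Fin n) : S i j = 0 := by
  by_contra hij
  have hcard := card_fiber_eq_of_commute hS hij
  have hj : ∀ t, ∃ s, j s = i t := by
    intro t
    have hpos : 0 < (Finset.univ.filter fun s => j s = i t).card := by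
      rw [← hcard]
      exact Finset.card_pos.2 ⟨t, by simp⟩
    obtain ⟨s, hs⟩ := Finset.card_pos.1 hpos
    exact ⟨s, by simpa using hs⟩
  choose f hf using hj
  have hfinj : Function.Injective f := fun a b hab => hi (by rw [← hf, ← hf, hab])
  let e : Equiv.Perm (Fin m) := Equiv.ofBijective f (Finite.injective_iff_bijective.1 hfinj)
  have hje : j = i ∘ e.symm := by
    ext1 s
    rw [Function.comp_apply, ← hf]
    exact congrArg j (e.apply_symm_apply s).symm
  obtain ⟨σ, hσ⟩ : ∃ σ : Equiv.Perm (Fin n), σ ∘ Fin.castLE hmn = i := by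
    obtain ⟨σ, hσ⟩ := Equiv.Perm.exists_extending_pair _ i (Fin.castLE_injective hmn) hi
    exact ⟨σ, funext hσ⟩
  have := h0 e.symm
  rw [← apply_comp_of_commute hS σ, ← Function.comp_assoc, hσ, ← hje] at this
  exact hij this

theorem row_eq_zero_of_update
    (hS : ∀ U ∈ Matrix.unitaryGroup (Fin n) ℂ, Commute S (tensorPow m U))
    {i : Fin m → Fin n} {a : Fin n} (ha : ∀ t, i t ≠ a) (s : Fin m)
    (hrow : ∀ j, S (Function.update i s a) j = 0) (j : Fin m → Fin n) : S i j = 0 := by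
  have hzero : ∀ f : Fin m → Fin n, (Finset.univ.filter fun t => f t = a).card = 0 ↔
      ∀ t, f t ≠ a := by
    intro f
    simp [Finset.filter_eq_empty_iff]
  by_contra hij
  have hja : ∀ t, j t ≠ a := by
    rw [← hzero, ← card_fiber_eq_of_commute hS hij, hzero]
    exact ha
  have hav : a ≠ i s := (ha s).symm
  have h := congrFun (congrFun (hS _ (reflection_mem_unitaryGroup hav)).eq
    (Function.update i s a)) j
  rw [Matrix.mul_apply, Matrix.mul_apply, Finset.sum_eq_zero fun b _ => by rw [hrow, zero_mul],
    Finset.sum_eq_single i] at h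
  · refine hij ((mul_eq_zero.1 h.symm).resolve_left ?_)
    rw [tensorPow, Matrix.of_apply, ← ne_eq, Finset.prod_ne_zero_iff]
    intro t _
    by_cases hts : t = s
    · subst hts
      simpa using (reflection_apply_ne_zero hav).1
    · simpa [hts] using (reflection_apply_ne_zero hav).2 (i t)
  · intro α _ hα
    by_contra hne
    have hαj : S α j ≠ 0 := right_ne_zero_of_mul hne
    have hαa : ∀ t, α t ≠ a := by
      rw [← hzero, card_fiber_eq_of_commute hS hαj, hzero]
      exact hja
    refine hα (funext fun t => ?_)
    have ht := Finset.prod_ne_zero_iff.1 (left_ne_zero_of_mul hne) t (Finset.mem_univ t)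
    have hcases := eq_or_of_reflection_apply_ne_zero ht
    have hat := hαa t
    have hit := ha t
    by_cases hts : t = s
    · subst hts
      rw [Function.update_self] at hcases
      grind
    · rw [Function.update_of_ne hts] at hcases
      grind
  · simp

/-- A matrix in the commutant of the tensor power representation of the unitary group, of order
at most the dimension, is determined by its row indexed by the first basis vectors. -/
theorem eq_zero_of_commute
    (hS : ∀ U ∈ Matrix.unitaryGroup (Fin n) ℂ, Commute S (tensorPow m U)) (hmn : m ≤ n)
    (h0 : ∀ π : Equiv.Perm (Fin m), S (Fin.castLE hmn) (Fin.castLE hmn ∘ π) = 0)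
    (i j : Fin m → Fin n) : S i j = 0 := by
  induction hN : m - (Finset.univ.image i).card using Nat.strong_induction_on generalizing i j with
  | _ N ih =>
  by_cases hi : Function.Injective i
  · exact apply_eq_zero_of_injective hS hmn h0 hi j
  have hlt : (Finset.univ.image i).card < m := by
    have hle := Finset.card_image_le (s := Finset.univ) (f := i)
    rw [Finset.card_univ, Fintype.card_fin] at hle
    refine lt_of_le_of_ne hle fun h => hi ?_
    rw [← Set.injOn_univ, ← Finset.coe_univ, ← Finset.card_image_iff, h, Finset.card_univ,
      Fintype.card_fin]
  obtain ⟨a, ha⟩ : ∃ a, a ∉ Finset.univ.image i := by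
    by_contra! hall
    have := Finset.eq_univ_iff_forall.2 hall
    rw [this, Finset.card_univ, Fintype.card_fin] at hlt
    omega
  have hai : ∀ t, i t ≠ a := by simpa using ha
  obtain ⟨s, s', hss, hne⟩ : ∃ s s', i s = i s' ∧ s ≠ s' := by
    simpa [Function.Injective] using hi
  refine row_eq_zero_of_update hS hai s (fun j' => ih _ ?_ _ j' rfl) j
  have hsub : insert a (Finset.univ.image i) ⊆ Finset.univ.image (Function.update i s a) := by
    intro x hx
    rw [Finset.mem_insert, Finset.mem_image] at hx
    rw [Finset.mem_image]
    rcases hx with rfl | ⟨t, -, rfl⟩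
    · exact ⟨s, Finset.mem_univ _, by simp⟩
    · by_cases hts : t = s
      · exact ⟨s', Finset.mem_univ _, by rw [Function.update_of_ne hne.symm, hts, hss]⟩
      · exact ⟨t, Finset.mem_univ _, by rw [Function.update_of_ne hts]⟩
  have hcard := Finset.card_le_card hsub
  rw [Finset.card_insert_of_notMem ha] at hcard
  omega

/-- The matrix permuting the tensor factors. -/
def factorPerm (n : ℕ) {m : ℕ} (π : Equiv.Perm (Fin m)) :
    Matrix (Fin m → Fin n) (Fin m → Fin n) ℂ :=
  Matrix.of fun i j => ∏ t, if j t = i (π t) then 1 else 0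

theorem factorPerm_apply (π : Equiv.Perm (Fin m)) (i j : Fin m → Fin n) :
    factorPerm n π i j = if j = i ∘ π then 1 else 0 := by
  simp only [factorPerm, Matrix.of_apply, Finset.prod_ite_zero,
    Finset.mem_univ, true_implies, funext_iff, Finset.prod_const_one, Function.comp_apply]

theorem factorPerm_commute (π : Equiv.Perm (Fin m)) (U : Matrix (Fin n) (Fin n) ℂ) :
    Commute (factorPerm n π) (tensorPow m U) := by
  ext i b
  have hb : ∀ a : Fin m → Fin n, b = a ∘ π ↔ a = b ∘ π.symm := by
    intro a
    rw [Equiv.eq_comp_symm, eq_comm]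
  simp only [Matrix.mul_apply, factorPerm_apply, hb, ite_mul, mul_ite, one_mul, mul_one, zero_mul,
    mul_zero, Finset.sum_ite_eq', Finset.mem_univ, if_true, tensorPow, Matrix.of_apply,
    Function.comp_apply]
  rw [← Equiv.prod_comp π fun t => U (i t) (b (π.symm t))]
  simp

theorem factorPerm_castLE (hmn : m ≤ n) (π π' : Equiv.Perm (Fin m)) :
    factorPerm n π' (Fin.castLE hmn) (Fin.castLE hmn ∘ π) = if π = π' then 1 else 0 := by
  rw [factorPerm_apply]
  congr 1
  rw [(Fin.castLE_injective hmn).comp_left.eq_iff, DFunLike.coe_fn_eq]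

/-- The commutant of the tensor power representation of the unitary group is spanned by the
permutations of the tensor factors, with coefficients read off from one row. -/
theorem eq_sum_factorPerm_of_commute
    (hS : ∀ U ∈ Matrix.unitaryGroup (Fin n) ℂ, Commute S (tensorPow m U)) (hmn : m ≤ n) :
    S = ∑ π : Equiv.Perm (Fin m), S (Fin.castLE hmn) (Fin.castLE hmn ∘ π) • factorPerm n π := by
  rw [← sub_eq_zero]
  ext i j
  refine eq_zero_of_commute (fun U hU => (hS U hU).sub_left ?_) hmn (fun π => ?_) i j
  · exact Commute.sum_left _ _ _ fun π _ => (factorPerm_commute π U).smul_left _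
  · simp [Matrix.sum_apply, factorPerm_castLE]

end Commutant

section Invariance

variable [Ring A] [Algebra ℂ A] {E : A →ₗ[ℂ] ℂ} {n : ℕ} {X : Matrix (Fin n) (Fin n) A}

theorem UnitarilyInvariant.list_prod (hX : UnitarilyInvariant (⇑E) X)
    {U : Matrix (Fin n) (Fin n) ℂ} (hU : U ∈ Matrix.unitaryGroup (Fin n) ℂ)
    {ι : Type*} (L : List ι) (i j : ι → Fin n) :
    E (L.map fun t => conjEntry U X (i t) (j t)).prod = E (L.map fun t => X (i t) (j t)).prod := by
  have h := hX U hU L.length (fun s => i (L.get s)) (fun s => j (L.get s))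
  have hL : ∀ f : ι → A, List.ofFn (fun s => f (L.get s)) = L.map f := by
    intro f
    rw [← Function.comp_def f L.get, ← List.map_ofFn, List.ofFn_get]
  rwa [hL (fun t => conjEntry U X (i t) (j t)), hL (fun t => X (i t) (j t))] at h

theorem UnitarilyInvariant.momentV (hX : UnitarilyInvariant (⇑E) X)
    {U : Matrix (Fin n) (Fin n) ℂ} (hU : U ∈ Matrix.unitaryGroup (Fin n) ℂ)
    {l : ℕ} (V : Setoid (Fin l)) (i j : Fin l → Fin n) :
    momentV (⇑E) V (fun t => conjEntry U X (i t) (j t))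
      = HOF.momentV (⇑E) V (fun t => X (i t) (j t)) := by
  unfold HOF.momentV
  exact finprod_mem_congr rfl fun B _ => hX.list_prod hU _ i j

theorem cumulant_commute (hX : UnitarilyInvariant (⇑E) X)
    {k : ∀ {l : ℕ}, Setoid (Fin l) → (Fin l → A) → ℂ} (hk : IsCumulant (⇑E) @k) {m : ℕ}
    (V : Setoid (Fin m)) {U : Matrix (Fin n) (Fin n) ℂ}
    (hU : U ∈ Matrix.unitaryGroup (Fin n) ℂ) :
    Commute (Matrix.of fun i j : Fin m → Fin n => k V fun t => X (i t) (j t))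
      (tensorPow m U) := by
  set T : Matrix (Fin m → Fin n) (Fin m → Fin n) ℂ :=
    Matrix.of fun i j : Fin m → Fin n => k V fun t => X (i t) (j t) with hT
  have key : T = tensorPow m U * T * (tensorPow m U).conjTranspose := by
    ext i j
    have h1 : k V (fun t => X (i t) (j t)) = k V (fun t => conjEntry U X (i t) (j t)) :=
      (hk.congr_of_momentV (fun W => hX.momentV hU W i j) V).symm
    have h2 := (hk.separatelyLinear V).map_sum_smul
      (fun t (p : Fin n × Fin n) => U (i t) p.1 * star (U (j t) p.2)) (fun p => X p.1 p.2)
    simp only [Fintype.sum_prod_type] at h2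
    rw [hT, Matrix.of_apply, h1]
    refine h2.trans ?_
    let e : (Fin m → Fin n) × (Fin m → Fin n) ≃ (Fin m → Fin n × Fin n) :=
      (Equiv.arrowProdEquivProdArrow (Fin m) (fun _ => Fin n) (fun _ => Fin n)).symm
    refine (e.sum_comp _).symm.trans ?_
    rw [Fintype.sum_prod_type, Finset.sum_comm]
    simp only [Matrix.mul_apply, Finset.sum_mul]
    refine Finset.sum_congr rfl fun b _ => Finset.sum_congr rfl fun a _ => ?_
    simp [e, tensorPow, Finset.prod_mul_distrib, Equiv.arrowProdEquivProdArrow]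
    ring
  change T * tensorPow m U = tensorPow m U * T
  conv_lhs => rw [key]
  rw [Matrix.mul_assoc, conjTranspose_tensorPow_mul m hU, Matrix.mul_one]

theorem kappa_eq_zero (hX : UnitarilyInvariant (⇑E) X)
    {k : ∀ {l : ℕ}, Setoid (Fin l) → (Fin l → A) → ℂ} (hk : IsCumulant (⇑E) @k) {m : ℕ}
    (hmn : m ≤ n) {V : Setoid (Fin m)} {π : Equiv.Perm (Fin m)}
    (hπ : ¬ permLePartition π V) : kappa @k X hmn V π = 0 := by
  unfold permLePartition at hπ
  push Not at hπ
  obtain ⟨t, ht⟩ := hπ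
  refine hk.eq_zero_of_momentV fun W hW => ?_
  have hWt : ¬ W (π t) t := fun h => ht (hW (W.symm h))
  rw [momentV_eq_prod]
  refine Finset.prod_eq_zero (i := {s | W s t}) (by simpa using Setoid.mem_classes W t) ?_
  let d : Fin n → ℂ := fun x => if x = Fin.castLE hmn (π t) then -1 else 1
  have hd : ∀ x, d x * star (d x) = 1 := by
    intro x
    by_cases hx : x = Fin.castLE hmn (π t) <;> simp [d, hx]
  have hU := diagonal_mem_unitaryGroup hd
  have hconj : ∀ i j, conjEntry (Matrix.diagonal d) X i j = (d i * star (d j)) • X i j := by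
    intro i j
    unfold conjEntry
    rw [Finset.sum_eq_single i, Finset.sum_eq_single j]
    · simp
    · intro b _ hb
      simp [Matrix.diagonal_apply_ne _ hb.symm]
    · simp
    · intro a _ ha
      simp [Matrix.diagonal_apply_ne _ ha.symm]
    · simp
  set L := (List.finRange m).filter (fun s => decide (s ∈ {s | W s t})) with hL
  have hmem : ∀ s, s ∈ L ↔ W s t := by simp [hL]
  have hnd : L.Nodup := (List.nodup_finRange m).filter _
  have h := hX.list_prod hU L (fun s => Fin.castLE hmn s) (fun s => Fin.castLE hmn (π s))
  have hneg : (L.map fun s => conjEntry (Matrix.diagonal d) X (Fin.castLE hmn s)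
        (Fin.castLE hmn (π s))).prod
      = -(L.map fun s => X (Fin.castLE hmn s) (Fin.castLE hmn (π s))).prod := by
    have htL : t ∈ L := (hmem t).2 (W.refl t)
    have hval : ∀ s ∈ L, conjEntry (Matrix.diagonal d) X (Fin.castLE hmn s)
        (Fin.castLE hmn (π s)) = (if s = t then (-1 : ℂ) else 1) •
          X (Fin.castLE hmn s) (Fin.castLE hmn (π s)) := by
      intro s hs
      have hst : s ≠ π t := fun h => hWt (h ▸ (hmem s).1 hs)
      rw [hconj]
      congr 1
      have hst' : Fin.castLE hmn s ≠ Fin.castLE hmn (π t) := by simpa using hst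
      by_cases h : s = t
      · subst h
        simp [d, hst']
      · have h' : π s ≠ π t := fun h'' => h (π.injective h'')
        simp [d, hst', h, h']
    rw [List.map_congr_left hval, prod_map_smul, ← List.prod_toFinset _ hnd,
      Finset.prod_ite_eq', if_pos (List.mem_toFinset.2 htL), neg_one_smul]
  rw [hneg, map_neg] at h
  exact self_eq_neg.1 h.symm

end Invariance

open scoped ComplexOrder in
/-- For a unitarily invariant random matrix with noncommutative entries, the
cumulants of the entries are described by a unique function `κ_{(V,π)}` on permutations,
supported on partitioned permutations and given by `κ_{(V,π)} = k_V(X_{1π(1)},…,X_{kπ(k)})`. -/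
theorem cumulants_of_entries_unitarily_invariant
    {A : Type*} [Ring A] [Algebra ℂ A] [StarRing A]
    (E : A →ₗ[ℂ] ℂ) (hE1 : E 1 = 1) (hEpos : ∀ x : A, x ≠ 0 → 0 < E (star x * x))
    (k : ∀ {l : ℕ}, Setoid (Fin l) → (Fin l → A) → ℂ) (hk : IsCumulant (⇑E) @k)
    {n : ℕ} (X : Matrix (Fin n) (Fin n) A) (hX : UnitarilyInvariant (⇑E) X)
    {m : ℕ} (hm : 1 ≤ m) (hmn : m ≤ n) (V : Setoid (Fin m)) :
    ((∀ i j : Fin m → Fin n,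
        k V (fun t => X (i t) (j t))
          = ∑ π : Equiv.Perm (Fin m),
              (∏ t : Fin m, if j t = i (π t) then (1 : ℂ) else 0) * kappa @k X hmn V π)
      ∧ (∀ π : Equiv.Perm (Fin m), ¬ permLePartition π V → kappa @k X hmn V π = 0))
    ∧ (∀ κ' : Equiv.Perm (Fin m) → ℂ,
        (∀ i j : Fin m → Fin n,
          k V (fun t => X (i t) (j t))
            = ∑ π : Equiv.Perm (Fin m),
                (∏ t : Fin m, if j t = i (π t) then (1 : ℂ) else 0) * κ' π) →
        (∀ π : Equiv.Perm (Fin m), ¬ permLePartition π V → κ' π = 0) →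
        κ' = fun π => kappa @k X hmn V π) := by
  have hrow : ∀ κ' : Equiv.Perm (Fin m) → ℂ, ∀ i j : Fin m → Fin n,
      ∑ π : Equiv.Perm (Fin m), (∏ t : Fin m, if j t = i (π t) then (1 : ℂ) else 0) * κ' π
        = (∑ π, κ' π • factorPerm n π) i j := by
    intro κ' i j
    simp only [Matrix.sum_apply, Matrix.smul_apply, smul_eq_mul, mul_comm (κ' _)]
    rfl
  refine ⟨⟨fun i j => ?_, fun π hπ => kappa_eq_zero hX hk hmn hπ⟩, fun κ' hκ' _ => ?_⟩
  · rw [hrow]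
    have h := eq_sum_factorPerm_of_commute (fun U hU => cumulant_commute hX hk V hU) hmn
    exact congrFun (congrFun h i) j
  · ext π
    have h := hκ' (Fin.castLE hmn) (Fin.castLE hmn ∘ π)
    rw [hrow] at h
    simp only [Matrix.sum_apply, Matrix.smul_apply, factorPerm_castLE] at h
    simpa [kappa] using h.symm

end HOF
end
end
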